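/- Main theorem (ranked word probabilities): Let p_0,...,p_n > 0 with ∑_{i=0}^n p_i = 1, treat ω_0 as a stop symbol, and assign to each finite word w over {ω_1,...,ω_n} (terminated by ω_0) the probability p_0·∏ of its letter probabilities. List all words in non-increasing order of probability and let p(r) be the probability of the r-th word. If some ratio ln p_i/ln p_j (1 ≤ i,j ≤ n) is irrational, and γ ∈ (0,1) is the unique root of ∑_{i=1}^n p_i^γ = 1, then lim_{r→∞} p(r)^{-γ}/(p_0^{-γ}·r) = H, where H = -γ ∑_{i=1}^n p_i^γ ln p_i. Equivalently, p(r) ~ p_0·H^{-1/γ}·r^{-1/γ} as r → ∞. -/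

import Mathlib

/-- The probability of the word `w` over the alphabet `Fin n` with letter
probabilities `p` and stop probability `p₀`. -/
def wordProb {n : ℕ} (p : Fin n → ℝ) (p₀ : ℝ) (w : List (Fin n)) : ℝ :=
  (w.map p).prod * p₀

open Filter Topology

/-- The total cost of the letters of a word. -/
def wordCost {ι : Type*} (a : ι → ℝ) (w : List ι) : ℝ := (w.map a).sum

/-- The number of words of cost at most `x`. -/
noncomputable def wordCount {ι : Type*} (a : ι → ℝ) (x : ℝ) : ℝ :=
  (Set.ncard {w : List ι | wordCost a w ≤ x} : ℝ)

/-- The exponentially normalized number of words of cost at most `x`. -/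
noncomputable def scaledCount {ι : Type*} (a : ι → ℝ) (γ x : ℝ) : ℝ :=
  Real.exp (-γ * x) * wordCount a x

section Counting

variable {ι : Type*} {a : ι → ℝ}

@[simp] lemma wordCost_nil : wordCost a [] = 0 := by simp [wordCost]

@[simp] lemma wordCost_cons (i : ι) (w : List ι) :
    wordCost a (i :: w) = a i + wordCost a w := by simp [wordCost]

@[simp] lemma wordCost_append (v w : List ι) :
    wordCost a (v ++ w) = wordCost a v + wordCost a w := by simp [wordCost]

@[simp] lemma wordCost_replicate (i : ι) (m : ℕ) :
    wordCost a (List.replicate m i) = m * a i := by simp [wordCost]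

lemma wordCost_nonneg (ha : ∀ i, 0 < a i) (w : List ι) : 0 ≤ wordCost a w := by
  induction w with
  | nil => simp
  | cons i w ih => simpa using add_nonneg (ha i).le ih

lemma finite_wordCost_le [Finite ι] (ha : ∀ i, 0 < a i) (x : ℝ) :
    {w : List ι | wordCost a w ≤ x}.Finite := by
  obtain ⟨d, hd, hda⟩ : ∃ d > 0, ∀ i, d ≤ a i := by
    rcases isEmpty_or_nonempty ι with h | h
    · exact ⟨1, one_pos, fun i => h.elim i⟩
    · obtain ⟨i, hi⟩ := Finite.exists_min a
      exact ⟨a i, ha i, hi⟩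
  have hlen : ∀ w : List ι, w.length * d ≤ wordCost a w := by
    intro w
    induction w with
    | nil => simp
    | cons i w ih =>
      have := hda i
      simp only [List.length_cons, Nat.cast_add, Nat.cast_one, wordCost_cons]
      linarith
  refine (List.finite_length_le ι ⌊x / d⌋₊).subset fun w hw => ?_
  refine Nat.le_floor ((le_div_iff₀ hd).2 ((hlen w).trans hw))

lemma wordCount_nonneg (x : ℝ) : 0 ≤ wordCount a x := Nat.cast_nonneg _

lemma wordCount_mono [Finite ι] (ha : ∀ i, 0 < a i) : Monotone (wordCount a) := by
  intro x y hxy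
  exact Nat.cast_le.2 (Set.ncard_le_ncard (fun w hw => le_trans hw hxy) (finite_wordCost_le ha y))

lemma wordCount_of_neg (ha : ∀ i, 0 < a i) {x : ℝ} (hx : x < 0) : wordCount a x = 0 := by
  have : {w : List ι | wordCost a w ≤ x} = ∅ := by
    ext w
    simpa using hx.trans_le (wordCost_nonneg ha w)
  simp [wordCount, this]

lemma wordCount_eq [Fintype ι] (ha : ∀ i, 0 < a i) {x : ℝ} (hx : 0 ≤ x) :
    wordCount a x = 1 + ∑ i, wordCount a (x - a i) := by
  have hset : {w : List ι | wordCost a w ≤ x} =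
      insert [] (Set.range fun s : Σ i, {w : List ι | wordCost a w ≤ x - a i} =>
        s.1 :: (s.2 : List ι)) := by
    ext w
    cases w with
    | nil => simp [hx]
    | cons i w => simp [le_sub_iff_add_le']
  have : ∀ y, Finite {w : List ι | wordCost a w ≤ y} := fun y => (finite_wordCost_le ha y)
  have hinj : Function.Injective fun s : Σ i, {w : List ι | wordCost a w ≤ x - a i} =>
        s.1 :: (s.2 : List ι) := by
    rintro ⟨i, v, hv⟩ ⟨j, w, hw⟩ h
    simp only [List.cons.injEq] at h
    obtain ⟨rfl, rfl⟩ := h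
    rfl
  have hcard : Set.ncard (Set.range fun s : Σ i, {w : List ι | wordCost a w ≤ x - a i} =>
        s.1 :: (s.2 : List ι)) = ∑ i, Set.ncard {w : List ι | wordCost a w ≤ x - a i} := by
    rw [← Set.image_univ, Set.ncard_image_of_injective _ hinj, Set.ncard_univ, Nat.card_sigma]
    simp
  unfold wordCount
  rw [hset, Set.ncard_insert_of_notMem (by simp) (Set.finite_range _), hcard]
  push_cast
  ring

end Counting

section ScaledCount

variable {ι : Type*} {a : ι → ℝ} {γ : ℝ}

lemma scaledCount_nonneg (x : ℝ) : 0 ≤ scaledCount a γ x :=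
  mul_nonneg (Real.exp_pos _).le (wordCount_nonneg x)

lemma scaledCount_of_neg (ha : ∀ i, 0 < a i) {x : ℝ} (hx : x < 0) : scaledCount a γ x = 0 := by
  simp [scaledCount, wordCount_of_neg ha hx]

lemma scaledCount_eq [Fintype ι] (ha : ∀ i, 0 < a i) {x : ℝ} (hx : 0 ≤ x) :
    scaledCount a γ x =
      Real.exp (-γ * x) + ∑ i, Real.exp (-γ * a i) * scaledCount a γ (x - a i) := by
  have h : ∀ i, Real.exp (-γ * a i) * scaledCount a γ (x - a i) =
      Real.exp (-γ * x) * wordCount a (x - a i) := by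
    intro i
    rw [scaledCount, ← mul_assoc, ← Real.exp_add]
    ring_nf
  simp_rw [h]
  rw [scaledCount, wordCount_eq ha hx, ← Finset.mul_sum]
  ring

lemma scaledCount_le_exp_mul [Finite ι] (ha : ∀ i, 0 < a i) (hγ : 0 < γ) {s t ε : ℝ} (hst : s ≤ t)
    (hε : t ≤ s + ε) : scaledCount a γ s ≤ Real.exp (γ * ε) * scaledCount a γ t := by
  rw [scaledCount, scaledCount, ← mul_assoc, ← Real.exp_add]
  refine mul_le_mul (Real.exp_le_exp.2 ?_) (wordCount_mono ha hst) (wordCount_nonneg _)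
    (Real.exp_pos _).le
  nlinarith

lemma intervalIntegrable_scaledCount [Finite ι] (ha : ∀ i, 0 < a i) (s t : ℝ) :
    IntervalIntegrable (scaledCount a γ) MeasureTheory.volume s t :=
  (wordCount_mono ha).intervalIntegrable.continuousOn_mul (by fun_prop)

lemma integral_exp_neg_mul (hγ : 0 < γ) (x : ℝ) :
    ∫ t in (0 : ℝ)..x, Real.exp (-γ * t) = (1 - Real.exp (-γ * x)) / γ := by
  rw [intervalIntegral.integral_comp_mul_left (fun t => Real.exp t) (neg_ne_zero.2 hγ.ne')]
  simp only [integral_exp, smul_eq_mul, mul_zero, Real.exp_zero]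
  field_simp
  ring

/-- The conserved quantity of the renewal equation. -/
lemma sum_integral_scaledCount [Fintype ι] (ha : ∀ i, 0 < a i) (hγ : 0 < γ)
    (hsum : ∑ i, Real.exp (-γ * a i) = 1) {x : ℝ} (hx : 0 ≤ x) :
    ∑ i, Real.exp (-γ * a i) * ∫ t in (x - a i)..x, scaledCount a γ t =
      (1 - Real.exp (-γ * x)) / γ := by
  have hint := intervalIntegrable_scaledCount (γ := γ) ha
  have hshift : ∀ i, IntervalIntegrable (fun t => scaledCount a γ (t - a i))
      MeasureTheory.volume 0 x := by
    intro i
    simpa using (hint (-a i) (x - a i)).comp_sub_right (a i)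
  have hneg : ∀ i, ∫ t in (-a i)..0, scaledCount a γ t = 0 := by
    intro i
    apply intervalIntegral.integral_zero_ae
    have : ∀ᵐ t : ℝ, t ≠ 0 := by simp [MeasureTheory.ae_iff]
    filter_upwards [this] with t ht0 ht
    rw [Set.uIoc_of_le (by linarith [ha i])] at ht
    exact scaledCount_of_neg ha (lt_of_le_of_ne ht.2 ht0)
  have hmain : ∫ t in (0 : ℝ)..x, scaledCount a γ t = (1 - Real.exp (-γ * x)) / γ +
      ∑ i, Real.exp (-γ * a i) * ∫ t in (0 : ℝ)..(x - a i), scaledCount a γ t := by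
    rw [← integral_exp_neg_mul hγ]
    have : ∫ t in (0 : ℝ)..x, scaledCount a γ t = ∫ t in (0 : ℝ)..x,
        (Real.exp (-γ * t) + ∑ i, Real.exp (-γ * a i) * scaledCount a γ (t - a i)) := by
      apply intervalIntegral.integral_congr
      intro t ht
      rw [Set.uIcc_of_le hx] at ht
      exact scaledCount_eq ha ht.1
    rw [this, intervalIntegral.integral_add, intervalIntegral.integral_finsetSum]
    · congr 1
      refine Finset.sum_congr rfl fun i _ => ?_
      rw [intervalIntegral.integral_const_mul, intervalIntegral.integral_comp_sub_right, zero_sub,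
        ← intervalIntegral.integral_add_adjacent_intervals (hint _ 0) (hint 0 _), hneg, zero_add]
    · exact fun i _ => (hshift i).const_mul _
    · exact Continuous.intervalIntegrable (by fun_prop) _ _
    · have hs := IntervalIntegrable.sum Finset.univ fun i _ =>
        (hshift i).const_mul (Real.exp (-γ * a i))
      simpa only [Finset.sum_fn] using hs
  simp_rw [← fun i => intervalIntegral.integral_interval_sub_left (hint 0 x) (hint 0 (x - a i)),
    mul_sub]
  rw [Finset.sum_sub_distrib, ← Finset.sum_mul, hsum, one_mul, hmain]
  ring

lemma exists_scaledCount_le [Fintype ι] [Nonempty ι] (ha : ∀ i, 0 < a i) (hγ : 0 < γ)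
    (hsum : ∑ i, Real.exp (-γ * a i) = 1) : ∃ C, ∀ x, scaledCount a γ x ≤ C := by
  obtain ⟨i⟩ := ‹Nonempty ι›
  have hi := ha i
  refine ⟨Real.exp (γ * a i) * (1 / (γ * Real.exp (-γ * a i) * a i)), fun y => ?_⟩
  rcases lt_or_ge y 0 with hy | hy
  · rw [scaledCount_of_neg ha hy]
    positivity
  have hcons := sum_integral_scaledCount ha hγ hsum (x := y + a i) (by linarith)
  have hterm : Real.exp (-γ * a i) * ∫ t in (y + a i - a i)..(y + a i), scaledCount a γ t ≤
      (1 - Real.exp (-γ * (y + a i))) / γ := by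
    rw [← hcons]
    refine Finset.single_le_sum (f := fun j => Real.exp (-γ * a j) *
      ∫ t in (y + a i - a j)..(y + a i), scaledCount a γ t) (fun j _ => ?_) (Finset.mem_univ i)
    exact mul_nonneg (Real.exp_pos _).le
      (intervalIntegral.integral_nonneg (by linarith [ha j]) fun t _ => scaledCount_nonneg t)
  have hle : (1 - Real.exp (-γ * (y + a i))) / γ ≤ 1 / γ := by
    gcongr
    linarith [Real.exp_pos (-γ * (y + a i))]
  have hlow : a i * (Real.exp (-(γ * a i)) * scaledCount a γ y) ≤
      ∫ t in (y + a i - a i)..(y + a i), scaledCount a γ t := by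
    have := intervalIntegral.integral_mono_on (a := y) (b := y + a i) (by linarith)
      (intervalIntegrable_const (c := Real.exp (-(γ * a i)) * scaledCount a γ y))
      (intervalIntegrable_scaledCount (γ := γ) ha y (y + a i)) (fun t ht => by
        rw [Real.exp_neg, inv_mul_le_iff₀ (Real.exp_pos _)]
        exact scaledCount_le_exp_mul ha hγ ht.1 ht.2)
    rw [intervalIntegral.integral_const, add_sub_cancel_left, smul_eq_mul] at this
    rwa [add_sub_cancel_right]
  have h := (mul_le_mul_of_nonneg_left hlow (Real.exp_pos (-γ * a i)).le).trans (hterm.trans hle)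
  rw [Real.exp_neg] at h
  have he := Real.exp_pos (γ * a i)
  have he' := Real.exp_pos (-γ * a i)
  have h2 := mul_le_mul_of_nonneg_left h (by positivity :
    0 ≤ Real.exp (γ * a i) / (Real.exp (-γ * a i) * a i))
  calc scaledCount a γ y = _ := ?_
    _ ≤ _ := h2
    _ = _ := ?_
  · field_simp
  · field_simp

end ScaledCount

/-- At a limit point equal to the limit superior, a solution of a renewal equation with vanishing
forcing takes the same limiting value at all shifts by word costs. -/
lemma tendsto_sub_wordCost {ι : Type*} [Fintype ι] {a q : ι → ℝ} {h f : ℝ → ℝ} {S : ℝ}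
    (hq : ∀ i, 0 < q i) (hq1 : ∑ i, q i = 1)
    (hrec : ∀ᶠ x in atTop, h x = f x + ∑ i, q i * h (x - a i))
    (hf : Tendsto f atTop (𝓝 0)) (hS : ∀ b > S, ∀ᶠ x in atTop, h x < b)
    (w : List ι) {l : Filter ℝ} (hl : l ≤ atTop) (hlS : Tendsto h l (𝓝 S)) :
    Tendsto (fun x => h (x - wordCost a w)) l (𝓝 S) := by
  have hsub : ∀ i, Tendsto (fun x => x - a i) atTop atTop := fun i =>
    tendsto_atTop_add_const_right _ _ tendsto_id
  induction w generalizing l with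
  | nil => simpa using hlS
  | cons i w ih =>
    have hstep : Tendsto (fun x => h (x - a i)) l (𝓝 S) := by
      rw [tendsto_order]
      refine ⟨fun b hb => ?_, fun b hb => hl ((hsub i).eventually (hS b hb))⟩
      set δ := (S - b) * q i / 3 with hδ
      have hδ0 : 0 < δ := by have := hq i; have : 0 < S - b := sub_pos.2 hb; positivity
      have hall : ∀ᶠ x in atTop, ∀ j, h (x - a j) < S + δ :=
        eventually_all.2 fun j => (hsub j).eventually (hS _ (by linarith))
      filter_upwards [hl hall, hl hrec, hl (hf.eventually (gt_mem_nhds hδ0)),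
        hlS.eventually (lt_mem_nhds (show S - δ < S by linarith))] with x h1 h2 h3 h4
      have hle : q i * (S + δ - h (x - a i)) ≤ ∑ j, q j * (S + δ - h (x - a j)) :=
        Finset.single_le_sum (f := fun j => q j * (S + δ - h (x - a j)))
          (fun j _ => mul_nonneg (hq j).le (by linarith [h1 j])) (Finset.mem_univ i)
      simp_rw [mul_sub (q _) (S + δ)] at hle
      rw [Finset.sum_sub_distrib, ← Finset.sum_mul, hq1] at hle
      have hqi := hq i
      have h5 : q i * (S - h (x - a i)) < q i * (S - b) := by nlinarith
      linarith [lt_of_mul_lt_mul_left h5 hqi.le]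
    have := ih (l := l.map fun x => x - a i) ((map_mono hl).trans (hsub i)) (tendsto_map'_iff.2 hstep)
    rw [tendsto_map'_iff] at this
    refine this.congr fun x => ?_
    simp [sub_sub]

/-- If two letter costs have irrational ratio, the word costs are asymptotically dense. -/
lemma exists_wordCost_mem_Icc {ι : Type*} {a : ι → ℝ} (ha : ∀ i, 0 < a i) {i j : ι}
    (hirr : Irrational (a i / a j)) {ε : ℝ} (hε : 0 < ε) :
    ∃ M, ∀ y ≥ M, ∃ w, wordCost a w ∈ Set.Icc y (y + ε) := by
  obtain ⟨d, hd, hdε⟩ := (dense_addSubgroupClosure_pair_iff.2 hirr).exists_mem_open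
    (isOpen_Ioo (a := 0) (b := ε)) ⟨ε / 2, by constructor <;> linarith⟩
  obtain ⟨u, v, huv⟩ := AddSubgroup.mem_closure_pair.1 hd
  have hd0 : 0 < d := hdε.1
  have hi := ha i
  have hj := ha j
  set c := a i + a j
  have hc : 0 < c := by positivity
  set K := ⌈c / d⌉₊
  set P := K * (u.natAbs + v.natAbs)
  have hcoef : ∀ z : ℤ, z.natAbs ≤ u.natAbs + v.natAbs → ∀ m ≤ K, ∀ k : ℕ,
      ∃ r : ℕ, (r : ℝ) = m * z + P + k := by
    intro z hz m hm k
    have h1 : (m * z.natAbs : ℤ) ≤ P := by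
      exact_mod_cast Nat.mul_le_mul hm hz
    have h2 : (0 : ℤ) ≤ m * z + P + k := by
      have : -(z.natAbs : ℤ) ≤ z := by omega
      nlinarith
    refine ⟨(m * z + P + k).toNat, ?_⟩
    have h3 : (((m * z + P + k).toNat : ℤ) : ℝ) = ((m * z + P + k : ℤ) : ℝ) := by
      rw [Int.toNat_of_nonneg h2]
    exact_mod_cast h3
  refine ⟨P * c, fun y hy => ?_⟩
  set k := ⌊(y - P * c) / c⌋₊
  have hk0 : 0 ≤ (y - P * c) / c := div_nonneg (by linarith) hc.le
  have hk1 : k * c ≤ y - P * c := (le_div_iff₀ hc).1 (Nat.floor_le hk0)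
  have hk2 : y - P * c < (k + 1) * c := (div_lt_iff₀ hc).1 (Nat.lt_floor_add_one _)
  set ρ := y - P * c - k * c
  have hρ0 : 0 ≤ ρ := by linarith
  have hρc : ρ ≤ c := by linarith
  set m := ⌈ρ / d⌉₊
  have hm : m ≤ K := Nat.ceil_mono (by gcongr)
  have hm1 : ρ ≤ m * d := (div_le_iff₀ hd0).1 (Nat.le_ceil _)
  have hm2 : m * d < ρ + d := by
    have := Nat.ceil_lt_add_one (div_nonneg hρ0 hd0.le)
    calc m * d < (ρ / d + 1) * d := by gcongr
      _ = ρ + d := by field_simp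
  obtain ⟨r, hr⟩ := hcoef u (by omega) m hm k
  obtain ⟨s, hs⟩ := hcoef v (by omega) m hm k
  refine ⟨List.replicate r i ++ List.replicate s j, ?_⟩
  have hcost : wordCost a (List.replicate r i ++ List.replicate s j) = m * d + P * c + k * c := by
    rw [wordCost_append, wordCost_replicate, wordCost_replicate, hr, hs, ← huv]
    simp only [zsmul_eq_mul, c]
    ring
  have := hdε.2
  rw [hcost]
  constructor <;> linarith

section Renewal

variable {ι : Type*} [Fintype ι] {a : ι → ℝ} {γ : ℝ}

lemma sum_exp_mul_pos [Nonempty ι] (ha : ∀ i, 0 < a i) : 0 < ∑ i, Real.exp (-γ * a i) * a i :=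
  Finset.sum_pos (fun i _ => mul_pos (Real.exp_pos _) (ha i)) Finset.univ_nonempty

/-- A value that is approached at all shifts by word costs is the renewal constant. -/
lemma eq_of_tendsto_sub_wordCost [Nonempty ι] (ha : ∀ i, 0 < a i) (hγ : 0 < γ)
    (hsum : ∑ i, Real.exp (-γ * a i) = 1) (hirr : ∃ i j, Irrational (a i / a j))
    {S : ℝ} {l : Filter ℝ} [l.NeBot] (hl : l ≤ atTop)
    (hS : ∀ w, Tendsto (fun x => scaledCount a γ (x - wordCost a w)) l (𝓝 S)) :
    S = (γ * ∑ i, Real.exp (-γ * a i) * a i)⁻¹ := by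
  obtain ⟨i₀, j₀, hij⟩ := hirr
  set μ := ∑ i, Real.exp (-γ * a i) * a i with hμ
  have hμ0 : 0 < μ := sum_exp_mul_pos ha
  have key : ∀ ε > 0, μ * (Real.exp (-(γ * ε)) * (S - ε)) ≤ 1 / γ ∧
      1 / γ ≤ μ * (Real.exp (γ * ε) * (S + ε)) := by
    intro ε hε
    obtain ⟨M, hM⟩ := exists_wordCost_mem_Icc ha hij hε
    set L := ∑ i, a i
    have hL : ∀ i, a i ≤ L := fun i =>
      Finset.single_le_sum (fun j _ => (ha j).le) (Finset.mem_univ i)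
    have hfin := finite_wordCost_le ha (M + 2 * ε + L)
    have hev : ∀ᶠ x in l, ∀ w ∈ {w | wordCost a w ≤ M + 2 * ε + L},
        scaledCount a γ (x - wordCost a w) ∈ Set.Ioo (S - ε) (S + ε) :=
      (eventually_all_finite hfin).2 fun w _ =>
        (hS w).eventually (Ioo_mem_nhds (by linarith) (by linarith))
    have hX : Tendsto (fun x => x - (M + ε)) l atTop :=
      (tendsto_atTop_add_const_right _ _ tendsto_id).mono_left hl
    have hlim : Tendsto (fun x => (1 - Real.exp (-γ * (x - (M + ε)))) / γ) l (𝓝 (1 / γ)) := by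
      have : Tendsto (fun x => Real.exp (-γ * (x - (M + ε)))) l (𝓝 0) :=
        Real.tendsto_exp_atBot.comp (hX.const_mul_atTop_of_neg (neg_neg_of_pos hγ))
      simpa using (this.const_sub 1).div_const γ
    have hbound : ∀ᶠ x in l,
        μ * (Real.exp (-(γ * ε)) * (S - ε)) ≤ (1 - Real.exp (-γ * (x - (M + ε)))) / γ ∧
        (1 - Real.exp (-γ * (x - (M + ε)))) / γ ≤ μ * (Real.exp (γ * ε) * (S + ε)) := by
      filter_upwards [hev, hX.eventually_ge_atTop 0] with x hx hx0
      set X := x - (M + ε) with hXdef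
      have hlow : ∀ t ∈ Set.Icc (X - L) X, Real.exp (-(γ * ε)) * (S - ε) ≤ scaledCount a γ t := by
        intro t ht
        obtain ⟨w, hw1, hw2⟩ := hM (x - t) (by linarith [ht.2])
        have h1 := (hx w (show wordCost a w ≤ _ by linarith [ht.1])).1
        rw [Real.exp_neg, inv_mul_le_iff₀ (Real.exp_pos _)]
        exact h1.le.trans (scaledCount_le_exp_mul ha hγ (by linarith) (by linarith))
      have hupp : ∀ t ∈ Set.Icc (X - L) X, scaledCount a γ t ≤ Real.exp (γ * ε) * (S + ε) := by
        intro t ht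
        obtain ⟨w, hw1, hw2⟩ := hM (x - t - ε) (by linarith [ht.2])
        have h1 := (hx w (show wordCost a w ≤ _ by linarith [ht.1])).2
        exact (scaledCount_le_exp_mul ha hγ (by linarith) (by linarith)).trans
          (mul_le_mul_of_nonneg_left h1.le (Real.exp_pos _).le)
      rw [← sum_integral_scaledCount ha hγ hsum hx0, hμ, Finset.sum_mul, Finset.sum_mul]
      have hint := fun i => intervalIntegrable_scaledCount (γ := γ) ha (X - a i) X
      have hsubset : ∀ i, ∀ t ∈ Set.Icc (X - a i) X, t ∈ Set.Icc (X - L) X := fun i t ht =>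
        ⟨by linarith [ht.1, hL i], ht.2⟩
      constructor
      · refine Finset.sum_le_sum fun i _ => ?_
        rw [mul_assoc]
        refine mul_le_mul_of_nonneg_left ?_ (Real.exp_pos _).le
        have := intervalIntegral.integral_mono_on (by linarith [ha i])
          (intervalIntegrable_const (c := Real.exp (-(γ * ε)) * (S - ε))) (hint i)
          fun t ht => hlow t (hsubset i t ht)
        rwa [intervalIntegral.integral_const, sub_sub_cancel, smul_eq_mul] at this
      · refine Finset.sum_le_sum fun i _ => ?_
        rw [mul_assoc]
        refine mul_le_mul_of_nonneg_left ?_ (Real.exp_pos _).le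
        have := intervalIntegral.integral_mono_on (by linarith [ha i]) (hint i)
          (intervalIntegrable_const (c := Real.exp (γ * ε) * (S + ε)))
          fun t ht => hupp t (hsubset i t ht)
        rwa [intervalIntegral.integral_const, sub_sub_cancel, smul_eq_mul] at this
    exact ⟨ge_of_tendsto hlim (hbound.mono fun x hx => hx.1),
      le_of_tendsto hlim (hbound.mono fun x hx => hx.2)⟩
  have hpos : ∀ᶠ ε : ℝ in 𝓝[>] 0, 0 < ε := self_mem_nhdsWithin
  have h1 : μ * S ≤ 1 / γ := by
    have hc : Continuous fun ε : ℝ => μ * (Real.exp (-(γ * ε)) * (S - ε)) := by fun_prop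
    have := (hc.tendsto 0).mono_left (nhdsWithin_le_nhds (s := Set.Ioi 0))
    simp only [mul_zero, neg_zero, Real.exp_zero, one_mul, sub_zero] at this
    exact le_of_tendsto this (hpos.mono fun ε hε => (key ε hε).1)
  have h2 : 1 / γ ≤ μ * S := by
    have hc : Continuous fun ε : ℝ => μ * (Real.exp (γ * ε) * (S + ε)) := by fun_prop
    have := (hc.tendsto 0).mono_left (nhdsWithin_le_nhds (s := Set.Ioi 0))
    simp only [mul_zero, Real.exp_zero, one_mul, add_zero] at this
    exact ge_of_tendsto this (hpos.mono fun ε hε => (key ε hε).2)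
  have h3 := le_antisymm h1 h2
  field_simp at h3 ⊢
  linarith

/-- A bounded real function has a largest limit point at infinity. -/
lemma exists_largest_limit_point {h : ℝ → ℝ} {A B : ℝ} (hA : ∀ x, A ≤ h x) (hB : ∀ x, h x ≤ B) :
    ∃ S, (∀ b > S, ∀ᶠ x in atTop, h x < b) ∧
      ∃ l : Filter ℝ, l.NeBot ∧ l ≤ atTop ∧ Tendsto h l (𝓝 S) := by
  have hbdd : IsBoundedUnder (· ≤ ·) atTop h := isBoundedUnder_of ⟨B, hB⟩
  have hbdd' : IsBoundedUnder (· ≥ ·) atTop h := isBoundedUnder_of ⟨A, hA⟩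
  have hup : ∀ b > limsup h atTop, ∀ᶠ x in atTop, h x < b := fun b hb =>
    eventually_lt_of_limsup_lt hb hbdd
  refine ⟨limsup h atTop, hup, ?_⟩
  have hcl : MapClusterPt (limsup h atTop) atTop h := by
    rw [mapClusterPt_iff_frequently]
    intro s hs
    obtain ⟨b, c, hbc, hsub⟩ := mem_nhds_iff_exists_Ioo_subset.1 hs
    exact ((frequently_lt_of_lt_limsup hbdd'.isCoboundedUnder_le hbc.1).and_eventually
      (hup c hbc.2)).mono fun x hx => hsub hx
  obtain ⟨U, hU, hUS⟩ := mapClusterPt_iff_ultrafilter.1 hcl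
  exact ⟨U, inferInstance, hU, hUS⟩

/-- The renewal theorem for the normalized word count. -/
theorem tendsto_scaledCount [Nonempty ι] (ha : ∀ i, 0 < a i) (hγ : 0 < γ)
    (hsum : ∑ i, Real.exp (-γ * a i) = 1) (hirr : ∃ i j, Irrational (a i / a j)) :
    Tendsto (scaledCount a γ) atTop (𝓝 (γ * ∑ i, Real.exp (-γ * a i) * a i)⁻¹) := by
  obtain ⟨C, hC⟩ := exists_scaledCount_le ha hγ hsum
  have hq : ∀ i, 0 < Real.exp (-γ * a i) := fun i => Real.exp_pos _
  have hf : Tendsto (fun x => Real.exp (-γ * x)) atTop (𝓝 0) :=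
    Real.tendsto_exp_atBot.comp (tendsto_id.const_mul_atTop_of_neg (neg_neg_of_pos hγ))
  have hrec : ∀ᶠ x in atTop, scaledCount a γ x =
      Real.exp (-γ * x) + ∑ i, Real.exp (-γ * a i) * scaledCount a γ (x - a i) :=
    (eventually_ge_atTop 0).mono fun x hx => scaledCount_eq ha hx
  obtain ⟨S, hS, l, hne, hl, hlS⟩ :=
    exists_largest_limit_point (scaledCount_nonneg (a := a) (γ := γ)) hC
  have hSeq := eq_of_tendsto_sub_wordCost ha hγ hsum hirr hl fun w =>
    tendsto_sub_wordCost hq hsum hrec hf hS w hl hlS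
  obtain ⟨I, hI, m, hne', hm, hmI⟩ := exists_largest_limit_point
    (h := fun x => -scaledCount a γ x) (fun x => neg_le_neg (hC x))
    (fun x => neg_nonpos.2 (scaledCount_nonneg x))
  have hrec' : ∀ᶠ x in atTop, -scaledCount a γ x =
      -Real.exp (-γ * x) + ∑ i, Real.exp (-γ * a i) * -scaledCount a γ (x - a i) := by
    filter_upwards [hrec] with x hx
    simp only [mul_neg, Finset.sum_neg_distrib]
    linarith
  have hIeq := eq_of_tendsto_sub_wordCost (S := -I) ha hγ hsum hirr hm fun w => by
    simpa using (tendsto_sub_wordCost hq hsum hrec' (by simpa using hf.neg) hI w hm hmI).neg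
  rw [tendsto_order]
  refine ⟨fun b hb => ?_, fun b hb => hS b (by rwa [hSeq])⟩
  filter_upwards [hI (-b) (by linarith)] with x hx
  linarith

/-- In an enumeration of all words by nondecreasing cost, `exp (γ * cost) / rank` converges. -/
theorem tendsto_exp_wordCost_div [Nonempty ι] (ha : ∀ i, 0 < a i) (hγ : 0 < γ)
    (hsum : ∑ i, Real.exp (-γ * a i) = 1) (hirr : ∃ i j, Irrational (a i / a j))
    {w : ℕ → List ι} (hbij : Function.Bijective w) (hmono : Monotone fun r => wordCost a (w r)) :
    Tendsto (fun r : ℕ => Real.exp (γ * wordCost a (w r)) / ((r : ℝ) + 1)) atTop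
      (𝓝 (γ * ∑ i, Real.exp (-γ * a i) * a i)) := by
  set H := γ * ∑ i, Real.exp (-γ * a i) * a i
  have hH : 0 < H := mul_pos hγ (sum_exp_mul_pos ha)
  have hge : ∀ r : ℕ, (r : ℝ) + 1 ≤ wordCount a (wordCost a (w r)) := by
    intro r
    have h : (w '' Set.Iic r).ncard ≤ Set.ncard {v | wordCost a v ≤ wordCost a (w r)} := by
      refine Set.ncard_le_ncard ?_ (finite_wordCost_le ha _)
      rintro _ ⟨s, hs, rfl⟩
      exact hmono hs
    rw [Set.ncard_image_of_injective _ hbij.1, ← Finset.coe_Iic, Set.ncard_coe_finset,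
      Nat.card_Iic] at h
    unfold wordCount
    exact_mod_cast h
  have hle : ∀ r : ℕ, ∀ x < wordCost a (w r), wordCount a x ≤ r := by
    intro r x hx
    have h : Set.ncard {v | wordCost a v ≤ x} ≤ (w '' Set.Iio r).ncard := by
      refine Set.ncard_le_ncard (fun v hv => ?_) ((Set.finite_Iio r).image w)
      obtain ⟨s, rfl⟩ := hbij.2 v
      refine ⟨s, ?_, rfl⟩
      by_contra hs
      exact absurd (hx.trans_le (hmono (not_lt.1 hs))) (not_lt.2 hv)
    rw [Set.ncard_image_of_injective _ hbij.1, ← Finset.coe_Iio, Set.ncard_coe_finset,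
      Nat.card_Iio] at h
    unfold wordCount
    exact_mod_cast h
  have hcost : Tendsto (fun r => wordCost a (w r)) atTop atTop := by
    refine tendsto_atTop_atTop_of_monotone hmono fun b => ?_
    obtain ⟨r, hr⟩ := exists_nat_gt (wordCount a b)
    refine ⟨r, ?_⟩
    by_contra! hb
    linarith [hge r, wordCount_mono ha hb.le]
  have hinv : Tendsto (fun x => (scaledCount a γ x)⁻¹) atTop (𝓝 H) := by
    have := (tendsto_scaledCount ha hγ hsum hirr).inv₀ (inv_ne_zero hH.ne')
    rwa [inv_inv] at this
  have hexp : ∀ x, (scaledCount a γ x)⁻¹ = Real.exp (γ * x) / wordCount a x := by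
    intro x
    rw [scaledCount, mul_inv, ← Real.exp_neg, neg_mul, neg_neg, div_eq_mul_inv]
  rw [tendsto_order]
  constructor
  · intro b hb
    filter_upwards [(hinv.comp hcost).eventually (lt_mem_nhds hb)] with r hr
    refine hr.trans_le ?_
    simp only [Function.comp_apply, hexp]
    gcongr
    exact hge r
  · intro b hb
    have hc : Continuous fun ε : ℝ => Real.exp (γ * ε) * H := by fun_prop
    have hlim := (hc.tendsto 0).mono_left (nhdsWithin_le_nhds (s := Set.Ioi 0))
    simp only [mul_zero, Real.exp_zero, one_mul] at hlim
    obtain ⟨ε, hεb, hε⟩ := ((hlim.eventually (gt_mem_nhds hb)).and self_mem_nhdsWithin).exists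
    have hε : 0 < ε := hε
    have hshift : Tendsto (fun r => wordCost a (w r) - ε) atTop atTop :=
      tendsto_atTop_add_const_right _ _ hcost
    have hlim' := (hinv.comp hshift).const_mul (Real.exp (γ * ε))
    filter_upwards [hlim'.eventually (gt_mem_nhds hεb),
      (hinv.comp hshift).eventually (lt_mem_nhds hH)] with r hr hr0
    refine lt_of_le_of_lt ?_ hr
    simp only [Function.comp_apply, hexp] at hr0 ⊢
    have hpos : 0 < wordCount a (wordCost a (w r) - ε) :=
      (div_pos_iff_of_pos_left (Real.exp_pos _)).1 hr0
    rw [← mul_div_assoc, ← Real.exp_add, ← mul_add, add_sub_cancel]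
    gcongr
    linarith [hle r _ (show wordCost a (w r) - ε < wordCost a (w r) by linarith)]

end Renewal

lemma wordProb_eq_exp {n : ℕ} {p : Fin n → ℝ} (hp : ∀ i, 0 < p i) (p₀ : ℝ) (w : List (Fin n)) :
    wordProb p p₀ w = Real.exp (-wordCost (fun i => -Real.log (p i)) w) * p₀ := by
  unfold wordProb
  congr 1
  induction w with
  | nil => simp
  | cons i w ih =>
    rw [List.map_cons, List.prod_cons, ih, wordCost_cons, neg_add, neg_neg, Real.exp_add,
      Real.exp_log (hp i)]

/-- Main theorem: for any enumeration `w` of all words in non-increasing order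
of probability (so that the `r`-th word, `r = 1,2,…`, is `w (r-1)`),
`p(r)^{-γ}/(p₀^{-γ}·r) → H`, where `H` is the entropy of `(p₁^γ,…,pₙ^γ)`. -/
theorem ranked_word_probability_asymptotics (n : ℕ) (hn : 2 ≤ n)
    (p : Fin n → ℝ) (p₀ : ℝ) (hp : ∀ i, 0 < p i) (hp₀ : 0 < p₀)
    (hsum : p₀ + ∑ i, p i = 1)
    (hirr : ∃ i j, Irrational (Real.log (p i) / Real.log (p j)))
    (γ : ℝ) (hγ0 : 0 < γ) (hγ1 : γ < 1) (hγ : ∑ i, p i ^ γ = 1)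
    (w : ℕ → List (Fin n)) (hbij : Function.Bijective w)
    (hmono : ∀ r s : ℕ, r ≤ s → wordProb p p₀ (w s) ≤ wordProb p p₀ (w r)) :
    Filter.Tendsto
      (fun r : ℕ =>
        wordProb p p₀ (w r) ^ (-γ) / (p₀ ^ (-γ) * ((r : ℝ) + 1)))
      Filter.atTop
      (nhds (-γ * ∑ i, p i ^ γ * Real.log (p i))) := by
  have : Nonempty (Fin n) := ⟨⟨0, by omega⟩⟩
  set a : Fin n → ℝ := fun i => -Real.log (p i) with ha_def
  have hp1 : ∀ i, p i < 1 := fun i => by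
    linarith [Finset.single_le_sum (fun j _ => (hp j).le) (Finset.mem_univ i)]
  have ha : ∀ i, 0 < a i := fun i => neg_pos.2 (Real.log_neg (hp i) (hp1 i))
  have hq : ∀ i, Real.exp (-γ * a i) = p i ^ γ := fun i => by
    rw [Real.rpow_def_of_pos (hp i)]
    congr 1
    simp only [ha_def]
    ring
  have hanti : Monotone fun r => wordCost a (w r) := by
    intro r s hrs
    have h := hmono r s hrs
    rw [wordProb_eq_exp hp, wordProb_eq_exp hp] at h
    exact neg_le_neg_iff.1 (Real.exp_le_exp.1 (le_of_mul_le_mul_right h hp₀))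
  have hirr' : ∃ i j, Irrational (a i / a j) := by
    simpa only [ha_def, neg_div_neg_eq] using hirr
  have hmain := tendsto_exp_wordCost_div ha hγ0 (by simpa only [hq] using hγ) hirr' hbij hanti
  have hH : γ * ∑ i, Real.exp (-γ * a i) * a i = -γ * ∑ i, p i ^ γ * Real.log (p i) := by
    simp_rw [hq, ha_def, mul_neg, Finset.sum_neg_distrib, neg_mul, mul_neg]
  rw [hH] at hmain
  refine hmain.congr fun r => ?_
  have hp₀' : p₀ ^ (-γ) ≠ 0 := (Real.rpow_pos_of_pos hp₀ _).ne'
  rw [wordProb_eq_exp hp, Real.mul_rpow (Real.exp_pos _).le hp₀.le, ← Real.exp_mul,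
    mul_comm (p₀ ^ (-γ)), mul_div_mul_right _ _ hp₀']
  congr 2
  ring
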